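/- For every n ≥ 0, a(3n, 0) = binom(3n, n)/(2n+1); equivalently, (2n+1)·a(3n, 0) = binom(3n, n). -/

import Mathlib

/- `a n k` counts partial S-Motzkin paths of length `n` ending at height `k`
whose last non-down step is an up step; `b n k` counts those whose last
non-down step is a level step.  They are defined by the coupled recurrences
`a n k = b (n-1) (k-1) + a (n-1) (k+1)` and `b n k = a (n-1) k + b (n-1) (k+1)`,
where a term with second index `-1` is interpreted as `0`, with initial values
`a 0 0 = 1`, `b 0 0 = 0` and `a 0 k = b 0 k = 0` for `k ≥ 1`. -/
mutual
  def a : ℕ → ℕ → ℕ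
    | 0, 0 => 1
    | 0, _ + 1 => 0
    | n + 1, 0 => a n 1
    | n + 1, k + 1 => b n k + a n (k + 2)
  def b : ℕ → ℕ → ℕ
    | 0, _ => 0
    | n + 1, k => a n k + b n (k + 1)
end

theorem a_b_eq_zero (n : ℕ) :
    (∀ k, n < 2 * k → a n k = 0) ∧ ∀ k, n < 2 * k + 1 → b n k = 0 := by
  induction n with
  | zero =>
    refine ⟨fun k hk => ?_, fun k _ => by rw [b]⟩
    obtain ⟨k, rfl⟩ : ∃ j, k = j + 1 := ⟨k - 1, by omega⟩
    rw [a]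
  | succ n ih =>
    refine ⟨fun k hk => ?_, fun k hk => ?_⟩
    · obtain ⟨k, rfl⟩ : ∃ j, k = j + 1 := ⟨k - 1, by omega⟩
      rw [a, ih.2 k (by omega), ih.1 (k + 2) (by omega)]
    · rw [b, ih.1 k (by omega), ih.2 (k + 1) (by omega)]

theorem a_b_diagonal (k : ℕ) : a (2 * k) k = 1 ∧ b (2 * k + 1) k = 1 := by
  have level (j : ℕ) (h : a (2 * j) j = 1) : b (2 * j + 1) j = 1 := by
    rw [b, h, (a_b_eq_zero (2 * j)).2 (j + 1) (by omega)]
  induction k with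
  | zero => exact ⟨by rw [a], level 0 (by rw [a])⟩
  | succ k ih =>
    have h : a (2 * (k + 1)) (k + 1) = 1 := by
      rw [show 2 * (k + 1) = 2 * k + 1 + 1 by ring, a, ih.2,
        (a_b_eq_zero (2 * k + 1)).1 (k + 2) (by omega)]
    exact ⟨h, level _ h⟩

theorem choose_three_mul_add_two (d : ℕ) :
    (3 * d + 2).choose (d + 1) = 2 * (3 * d + 2).choose d := by
  have h := Nat.choose_succ_right_eq (3 * d + 2) d
  rw [show 3 * d + 2 - d = 2 * (d + 1) by omega] at h
  apply Nat.eq_of_mul_eq_mul_right (Nat.succ_pos d)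
  linarith

/-- The ballot-type formula: a path with `d + 1` down steps is counted by
`choose n (d + 1) - 2 * choose n d`. -/
theorem a_b_add_two_mul_choose (n : ℕ) :
    (∀ k d, n = 2 * k + 3 * (d + 1) → a n k + 2 * n.choose d = n.choose (d + 1)) ∧
    ∀ k d, n = 2 * k + 1 + 3 * (d + 1) → b n k + 2 * n.choose d = n.choose (d + 1) := by
  induction n with
  | zero => exact ⟨fun k d h => by omega, fun k d h => by omega⟩
  | succ n ih =>
    obtain ⟨iha, ihb⟩ := ih
    refine ⟨fun k d h => ?_, fun k d h => ?_⟩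
    · rcases k with _ | k
      · have hn : n = 3 * d + 2 := by omega
        have hc := choose_three_mul_add_two d
        rw [← hn] at hc
        rw [a]
        rcases d with _ | d
        · subst hn
          rw [(a_b_diagonal 1).1]
          rfl
        · have := iha 1 d (by omega)
          rw [Nat.choose_succ_succ n d, Nat.choose_succ_succ n (d + 1)]
          simp only [Nat.succ_eq_add_one]
          omega
      · rw [a]
        have hb := ihb k d (by omega)
        rcases d with _ | d
        · have := (a_b_diagonal (k + 2)).1
          rw [show 2 * (k + 2) = n by omega] at this
          simp only [zero_add, Nat.choose_zero_right, Nat.choose_one_right] at *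
          omega
        · have := iha (k + 2) d (by omega)
          rw [Nat.choose_succ_succ n d, Nat.choose_succ_succ n (d + 1)]
          simp only [Nat.succ_eq_add_one]
          omega
    · rw [b]
      have ha := iha k d (by omega)
      rcases d with _ | d
      · have := (a_b_diagonal (k + 1)).2
        rw [show 2 * (k + 1) + 1 = n by omega] at this
        simp only [zero_add, Nat.choose_zero_right, Nat.choose_one_right] at *
        omega
      · have := ihb (k + 1) d (by omega)
        rw [Nat.choose_succ_succ n d, Nat.choose_succ_succ n (d + 1)]
        simp only [Nat.succ_eq_add_one]
        omega

theorem a_three_n_zero (n : ℕ) :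
    (2 * n + 1) * a (3 * n) 0 = Nat.choose (3 * n) n := by
  rcases n with _ | d
  · simp [a]
  · have h := (a_b_add_two_mul_choose (3 * (d + 1))).1 0 d (by ring)
    have hc := Nat.choose_succ_right_eq (3 * (d + 1)) d
    rw [show 3 * (d + 1) - d = 2 * (d + 1) + 1 by omega] at hc
    nlinarith
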